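/- The logarithmic derivative of the Dedekind eta function satisfies η'/η = (1/6)·(ξ₂ + ξ₃ + ξ₄) at every point of ℍ. -/

import Mathlib

open Complex

noncomputable section

/-- `q = e^{2πiτ}`. -/
def qexp (τ : ℂ) : ℂ := Complex.exp (2 * ↑Real.pi * Complex.I * τ)

/-- `q^s = e^{2πisτ}` for real `s`. -/
def qpow (s : ℝ) (τ : ℂ) : ℂ := Complex.exp (2 * ↑Real.pi * Complex.I * ↑s * τ)

/-- The differential operator `f' = (1/(2πi)) df/dτ` (i.e. `q d/dq`). -/
def Dq (f : ℂ → ℂ) : ℂ → ℂ := fun τ => deriv f τ / (2 * ↑Real.pi * Complex.I)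

/-- The divisor power sum `σ_k(n)`. -/
def sigma' (k n : ℕ) : ℕ := ∑ d ∈ n.divisors, d ^ k

/-- The quasimodular Eisenstein series `E₂`. -/
def E2 (τ : ℂ) : ℂ := 1 - 24 * ∑' n : ℕ, (sigma' 1 (n + 1) : ℂ) * qexp τ ^ (n + 1)

/-- The Eisenstein series `E₄`. -/
def E4 (τ : ℂ) : ℂ := 1 + 240 * ∑' n : ℕ, (sigma' 3 (n + 1) : ℂ) * qexp τ ^ (n + 1)

/-- The Eisenstein series `E₆`. -/
def E6 (τ : ℂ) : ℂ := 1 - 504 * ∑' n : ℕ, (sigma' 5 (n + 1) : ℂ) * qexp τ ^ (n + 1)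

/-- The Dedekind eta function `η(τ) = q^{1/24} ∏ (1 - qⁿ)`. -/
def η (τ : ℂ) : ℂ := qpow (1/24) τ * ∏' n : ℕ, (1 - qexp τ ^ (n + 1))

/-- Theta constant `θ₂(τ) = Σ_{n∈ℤ} q^{(n-1/2)²/2}`. -/
def θ₂ (τ : ℂ) : ℂ := ∑' n : ℤ, qpow (((n : ℝ) - 1/2) ^ 2 / 2) τ

/-- Theta constant `θ₃(τ) = Σ_{n∈ℤ} q^{n²/2}`. -/
def θ₃ (τ : ℂ) : ℂ := ∑' n : ℤ, qpow ((n : ℝ) ^ 2 / 2) τ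

/-- Theta constant `θ₄(τ) = Σ_{n∈ℤ} (-1)ⁿ q^{n²/2}`. -/
def θ₄ (τ : ℂ) : ℂ := ∑' n : ℤ, (-1 : ℂ) ^ n * qpow ((n : ℝ) ^ 2 / 2) τ

/-- `ξ₂ = 2 θ₂'/θ₂`. -/
def ξ₂ : ℂ → ℂ := fun τ => 2 * Dq θ₂ τ / θ₂ τ

/-- `ξ₃ = 2 θ₃'/θ₃`. -/
def ξ₃ : ℂ → ℂ := fun τ => 2 * Dq θ₃ τ / θ₃ τ

/-- `ξ₄ = 2 θ₄'/θ₄`. -/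
def ξ₄ : ℂ → ℂ := fun τ => 2 * Dq θ₄ τ / θ₄ τ

/-- `h₀ = 4ξ₂ - 2ξ₃ - 2ξ₄` (equal to `η⁴ χ_{Λ₀}^{q}`). -/
def h₀ : ℂ → ℂ := fun τ => 4 * ξ₂ τ - 2 * ξ₃ τ - 2 * ξ₄ τ

/-- `h₁ = 2ξ₃ - 2ξ₄` (equal to `η⁴ χ_{Λ₁}^{q}`). -/
def h₁ : ℂ → ℂ := fun τ => 2 * ξ₃ τ - 2 * ξ₄ τ

/-- The Serre-type derivative `∂_k f = f' - (k/12) E₂ f`. -/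
def partialD (k : ℂ) (f : ℂ → ℂ) : ℂ → ℂ := fun τ => Dq f τ - k / 12 * E2 τ * f τ

end

open Filter Topology Finset

/-- The partial products `∏ (1 - qᵏ)` over `1 ≤ k ≤ n`. -/
noncomputable def eulerProd (q : ℂ) (n : ℕ) : ℂ := ∏ k ∈ range n, (1 - q ^ (k + 1))

/-- The inverse of `eulerProd q`, extended by zero to negative integers. -/
noncomputable def invEulerProd (q : ℂ) : ℤ → ℂ
  | .ofNat n => (eulerProd q n)⁻¹
  | .negSucc _ => 0

section EulerProd

variable {q : ℂ}

lemma one_sub_pow_succ_ne_zero (hq : ‖q‖ < 1) (k : ℕ) : 1 - q ^ (k + 1) ≠ 0 := by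
  intro h
  have h1 : ‖q ^ (k + 1)‖ = 1 := by rw [← sub_eq_zero.mp h, norm_one]
  rw [norm_pow] at h1
  exact (pow_lt_one₀ (norm_nonneg _) hq k.succ_ne_zero).ne h1

lemma eulerProd_ne_zero (hq : ‖q‖ < 1) (n : ℕ) : eulerProd q n ≠ 0 :=
  prod_ne_zero_iff.mpr fun k _ ↦ one_sub_pow_succ_ne_zero hq k

lemma eulerProd_succ (q : ℂ) (n : ℕ) :
    eulerProd q (n + 1) = eulerProd q n * (1 - q ^ (n + 1)) :=
  prod_range_succ _ _

lemma tendsto_eulerProd (hq : ‖q‖ < 1) :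
    Tendsto (eulerProd q) atTop (𝓝 (∏' n : ℕ, (1 - q ^ (n + 1)))) :=
  (ModularForm.multipliable_one_sub_pow hq).tendsto_prod_tprod_nat

lemma tprod_one_sub_pow_ne_zero (hq : ‖q‖ < 1) : ∏' n : ℕ, (1 - q ^ (n + 1)) ≠ 0 := by
  simp_rw [sub_eq_add_neg]
  refine tprod_one_add_ne_zero_of_summable
    (fun k ↦ by simpa [sub_eq_add_neg] using one_sub_pow_succ_ne_zero hq k) ?_
  simpa using (summable_nat_add_iff 1).mpr (summable_geometric_of_lt_one (norm_nonneg _) hq)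

lemma invEulerProd_sub_one (hq : ‖q‖ < 1) (m : ℤ) :
    invEulerProd q (m - 1) = (1 - q ^ m) * invEulerProd q m := by
  rcases m with (_ | n) | n
  · simp only [Int.ofNat_eq_natCast, Nat.cast_zero, zpow_zero, sub_self, zero_mul]
    rfl
  · have h : Int.ofNat (n + 1) - 1 = Int.ofNat n := by simp
    have h0 := one_sub_pow_succ_ne_zero hq n
    have h1 := eulerProd_ne_zero hq n
    rw [h]
    simp only [invEulerProd, eulerProd_succ, Int.ofNat_eq_natCast, zpow_natCast]
    field_simp
  · have h : Int.negSucc n - 1 = Int.negSucc (n + 1) := by lia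
    simp [h, invEulerProd]

lemma tendsto_invEulerProd (hq : ‖q‖ < 1) :
    Tendsto (invEulerProd q) atTop (𝓝 (∏' n : ℕ, (1 - q ^ (n + 1)))⁻¹) := by
  rw [← Nat.map_cast_int_atTop, tendsto_map'_iff]
  exact (tendsto_eulerProd hq).inv₀ (tprod_one_sub_pow_ne_zero hq)

lemma exists_norm_invEulerProd_le (hq : ‖q‖ < 1) : ∃ M, ∀ m, ‖invEulerProd q m‖ ≤ M := by
  obtain ⟨M, hM⟩ := ((tendsto_eulerProd hq).inv₀
    (tprod_one_sub_pow_ne_zero hq)).norm.bddAbove_range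
  refine ⟨M, fun m ↦ ?_⟩
  have h (n : ℕ) : ‖(eulerProd q n)⁻¹‖ ≤ M := hM ⟨n, rfl⟩
  rcases m with n | n
  · exact h n
  · simpa [invEulerProd] using (norm_nonneg _).trans (h 0)

end EulerProd

/-- The finite form of the Jacobi triple product identity. -/
lemma hasSum_finite_jacobi_triple {x z : ℂ} (hx0 : x ≠ 0) (hx : ‖x ^ 2‖ < 1) (hz : z ≠ 0)
    (n : ℕ) :
    HasSum (fun j : ℤ ↦ eulerProd (x ^ 2) (2 * n) *
        (invEulerProd (x ^ 2) (n - j) * invEulerProd (x ^ 2) (n + j) * (x ^ j ^ 2 * z ^ j)))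
      (∏ k ∈ range n, (1 + z * x ^ (2 * k + 1)) * (1 + z⁻¹ * x ^ (2 * k + 1))) := by
  induction n with
  | zero =>
    have h0 (j : ℤ) (hj : j ≠ 0) : eulerProd (x ^ 2) (2 * 0) *
        (invEulerProd (x ^ 2) ((0 : ℕ) - j) * invEulerProd (x ^ 2) ((0 : ℕ) + j) *
          (x ^ j ^ 2 * z ^ j)) = 0 := by
      rcases j with (_ | n) | n
      · exact absurd rfl hj
      · have : invEulerProd (x ^ 2) ((0 : ℕ) - Int.ofNat (n + 1)) = 0 := by
          rw [show ((0 : ℕ) : ℤ) - Int.ofNat (n + 1) = Int.negSucc n by lia, invEulerProd]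
        rw [this]
        ring
      · simp [invEulerProd]
    convert! hasSum_single (0 : ℤ) h0 using 1
    simp [eulerProd, invEulerProd]
  | succ n ih =>
    have hs := (Equiv.subRight (1 : ℤ)).hasSum_iff.mpr ih
    have ha := (Equiv.addRight (1 : ℤ)).hasSum_iff.mpr ih
    have key := ((ih.mul_left (1 + x ^ (4 * n + 2))).add
      (hs.mul_left (x ^ (2 * n + 1) * z))).add (ha.mul_left (x ^ (2 * n + 1) * z⁻¹))
    rw [prod_range_succ]
    convert! key using 1
    · ext j
      have hR := invEulerProd_sub_one hx
      have e1 := hR (n + 1 - j)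
      have e2 := hR (n + 1 - j - 1)
      have e3 := hR (n + 1 + j)
      have e4 := hR (n + 1 + j - 1)
      rw [e1] at e2
      rw [e3] at e4
      have E : eulerProd (x ^ 2) (2 * (n + 1)) =
          eulerProd (x ^ 2) (2 * n) * (1 - (x ^ 2) ^ (2 * n + 1)) * (1 - (x ^ 2) ^ (2 * n + 2)) := by
        rw [mul_add, mul_one, eulerProd_succ, eulerProd_succ]
      simp only [Function.comp, Equiv.coe_addRight, Equiv.subRight_apply, Nat.cast_add,
        Nat.cast_one, E]
      rw [show (n : ℤ) - j = n + 1 - j - 1 by ring, show (n : ℤ) + j = n + 1 + j - 1 by ring,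
        show (n : ℤ) - (j - 1) = n + 1 - j by ring,
        show (n : ℤ) + (j - 1) = n + 1 + j - 1 - 1 by ring,
        show (n : ℤ) - (j + 1) = n + 1 - j - 1 - 1 by ring,
        show (n : ℤ) + (j + 1) = n + 1 + j by ring, e1, e2, e3, e4]
      generalize invEulerProd (x ^ 2) (n + 1 - j) = r
      generalize invEulerProd (x ^ 2) (n + 1 + j) = s
      generalize eulerProd (x ^ 2) (2 * n) = e
      have h1 : x ^ (j - 1) ^ 2 = x ^ j ^ 2 * (x ^ j)⁻¹ ^ 2 * x := by
        rw [← zpow_neg, ← zpow_natCast, ← zpow_mul, ← zpow_add₀ hx0, ← zpow_add_one₀ hx0]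
        ring_nf
      have h2 : x ^ (j + 1) ^ 2 = x ^ j ^ 2 * (x ^ j) ^ 2 * x := by
        rw [← zpow_natCast (x ^ j), ← zpow_mul, ← zpow_add₀ hx0, ← zpow_add_one₀ hx0]
        ring_nf
      have hx2 : x ^ 2 ≠ 0 := pow_ne_zero 2 hx0
      have hj : (x ^ 2) ^ j = (x ^ j) ^ 2 := by
        rw [← zpow_natCast, ← zpow_natCast, ← zpow_mul, ← zpow_mul, mul_comm]
      have hn : (x ^ 2) ^ ((n : ℤ) + 1) = x ^ (2 * n + 2) := by
        rw [← Nat.cast_succ, zpow_natCast, ← pow_mul, Nat.mul_succ]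
      rw [h1, h2, zpow_sub_one₀ hz, zpow_add_one₀ hz, zpow_sub_one₀ hx2, zpow_sub_one₀ hx2,
        zpow_sub₀ hx2, zpow_add₀ hx2 ((n : ℤ) + 1), hn, hj]
      have hxj : x ^ j ≠ 0 := zpow_ne_zero _ hx0
      generalize x ^ j = y at *
      generalize x ^ j ^ 2 = u
      have hzj : z ^ j ≠ 0 := zpow_ne_zero _ hz
      generalize z ^ j = v at *
      field_simp
      ring
    · field_simp
      ring

/-- The **Jacobi triple product identity**, with the product as a limit of partial products. -/
lemma tendsto_jacobi_triple (w : ℂ) {τ : ℂ} (hτ : 0 < τ.im) :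
    Tendsto (fun n ↦ ∏ k ∈ range n, (1 + cexp (2 * Real.pi * I * w) *
        cexp (Real.pi * I * τ) ^ (2 * k + 1)) *
        (1 + (cexp (2 * Real.pi * I * w))⁻¹ * cexp (Real.pi * I * τ) ^ (2 * k + 1))) atTop
      (𝓝 (jacobiTheta₂ w τ / ∏' n : ℕ, (1 - (cexp (Real.pi * I * τ) ^ 2) ^ (n + 1)))) := by
  have hx : ‖cexp (Real.pi * I * τ) ^ 2‖ < 1 := by
    rw [← Complex.exp_nat_mul, Complex.norm_exp]
    simpa using by positivity
  have hterm (j : ℤ) : cexp (Real.pi * I * τ) ^ j ^ 2 * cexp (2 * Real.pi * I * w) ^ j =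
      jacobiTheta₂_term j w τ := by
    rw [jacobiTheta₂_term, ← Complex.exp_int_mul, ← Complex.exp_int_mul, ← Complex.exp_add]
    push_cast
    ring_nf
  have hfin := hasSum_finite_jacobi_triple (Complex.exp_ne_zero (Real.pi * I * τ)) hx
    (Complex.exp_ne_zero (2 * Real.pi * I * w))
  simp_rw [hterm] at hfin
  simp_rw [← fun n ↦ (hfin n).tsum_eq, tsum_mul_left]
  generalize cexp (Real.pi * I * τ) ^ 2 = q at hx ⊢
  have hE := tendsto_eulerProd hx
  have hR := tendsto_invEulerProd hx
  have hP := tprod_one_sub_pow_ne_zero hx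
  obtain ⟨M, hM⟩ := exists_norm_invEulerProd_le hx
  generalize ∏' n : ℕ, (1 - q ^ (n + 1)) = P at *
  have hM0 : 0 ≤ M := (norm_nonneg _).trans (hM 0)
  have hlim : Tendsto (fun n : ℕ ↦ ∑' j : ℤ, invEulerProd q (n - j) * invEulerProd q (n + j) *
      jacobiTheta₂_term j w τ) atTop (𝓝 (∑' j : ℤ, P⁻¹ * P⁻¹ * jacobiTheta₂_term j w τ)) := by
    refine tendsto_tsum_of_dominated_convergence
      (bound := fun j ↦ M * M * ‖jacobiTheta₂_term j w τ‖)
      (((summable_jacobiTheta₂_term_iff w τ).mpr hτ).norm.mul_left _) (fun j ↦ ?_)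
      (.of_forall fun n j ↦ ?_)
    · refine ((hR.comp ?_).mul (hR.comp ?_)).mul_const _
      · exact tendsto_atTop_add_const_right _ (-j) tendsto_natCast_atTop_atTop
      · exact tendsto_atTop_add_const_right _ j tendsto_natCast_atTop_atTop
    · rw [norm_mul, norm_mul]
      gcongr <;> exact hM _
  have h2 : Tendsto (fun n : ℕ ↦ 2 * n) atTop atTop :=
    tendsto_id.const_mul_atTop' two_pos
  convert! (hE.comp h2).mul hlim using 2
  rw [tsum_mul_left, ← jacobiTheta₂]
  field_simp

/-- The product formula `2 η³ = θ₂ θ₃ θ₄`, without the fractional powers of `q`. -/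
lemma jacobiTheta₂_mul_mul {τ : ℂ} (hτ : 0 < τ.im) :
    jacobiTheta₂ (-τ / 2) τ * jacobiTheta₂ 0 τ * jacobiTheta₂ (1 / 2) τ =
      2 * (∏' n : ℕ, (1 - qexp τ ^ (n + 1))) ^ 3 := by
  have hx : cexp (Real.pi * I * τ) ^ 2 = qexp τ := by
    rw [← Complex.exp_nat_mul, qexp]
    push_cast
    ring_nf
  have hq : ‖qexp τ‖ < 1 := by
    rw [qexp, Complex.norm_exp]
    simpa using by positivity
  have h0 := tendsto_jacobi_triple 0 hτ
  have h1 := tendsto_jacobi_triple (1 / 2) hτ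
  have h2 := tendsto_jacobi_triple (-τ / 2) hτ
  rw [show 2 * Real.pi * I * (1 / 2) = Real.pi * I by ring, exp_pi_mul_I] at h1
  rw [show 2 * Real.pi * I * (-τ / 2) = -(Real.pi * I * τ) by ring, Complex.exp_neg] at h2
  rw [mul_zero, Complex.exp_zero] at h0
  rw [hx] at h0 h1 h2
  have hx0 := Complex.exp_ne_zero (Real.pi * I * τ)
  generalize cexp (Real.pi * I * τ) = x at *
  have hP := tprod_one_sub_pow_ne_zero hq
  have hE := tendsto_eulerProd hq
  have hE2 := hE.comp
    (tendsto_id.const_mul_atTop' two_pos : Tendsto (fun n : ℕ ↦ 2 * n) atTop atTop)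
  have hpow := (tendsto_pow_atTop_nhds_zero_of_norm_lt_one hq).const_add 1
  have hG (n : ℕ) : (∏ k ∈ range n, (1 + x ^ (2 * k + 1)) * (1 - x ^ (2 * k + 1)) *
      (1 + x ^ (2 * k + 2))) * eulerProd (qexp τ) n = eulerProd (qexp τ) (2 * n) := by
    induction n with
    | zero => simp [eulerProd]
    | succ n ih =>
      rw [mul_add, mul_one, eulerProd_succ, eulerProd_succ, eulerProd_succ, prod_range_succ, ← ih,
        ← hx]
      ring
  have hF (n : ℕ) : (1 + qexp τ ^ n) *
      (((∏ k ∈ range n, (1 + x⁻¹ * x ^ (2 * k + 1)) * (1 + x⁻¹⁻¹ * x ^ (2 * k + 1))) *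
      ∏ k ∈ range n, (1 + 1 * x ^ (2 * k + 1)) * (1 + 1⁻¹ * x ^ (2 * k + 1))) *
      ∏ k ∈ range n, (1 + -1 * x ^ (2 * k + 1)) * (1 + (-1)⁻¹ * x ^ (2 * k + 1))) =
      2 * (eulerProd (qexp τ) (2 * n) / eulerProd (qexp τ) n) ^ 2 := by
    rw [← hG, mul_div_cancel_right₀ _ (eulerProd_ne_zero hq n), ← hx]
    induction n with
    | zero => norm_num
    | succ n ih =>
      simp only [prod_range_succ, mul_pow, inv_neg, inv_one, inv_inv] at ih ⊢
      have hn : x⁻¹ * x ^ (2 * n + 1) = (x ^ 2) ^ n := by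
        rw [pow_succ, pow_mul]
        field_simp
      rw [hn]
      generalize ∏ k ∈ range n, (1 + x⁻¹ * x ^ (2 * k + 1)) * (1 + x * x ^ (2 * k + 1)) = a at *
      generalize ∏ k ∈ range n, (1 + 1 * x ^ (2 * k + 1)) * (1 + 1 * x ^ (2 * k + 1)) = b at *
      generalize ∏ k ∈ range n, (1 + -1 * x ^ (2 * k + 1)) * (1 + -1 * x ^ (2 * k + 1)) = c at *
      rw [← mul_assoc 2, ← ih]
      ring
  have hlim := hpow.mul ((h2.mul h0).mul h1)
  simp_rw [hF] at hlim
  have := tendsto_nhds_unique hlim (((hE2.div hE hP).pow 2).const_mul 2)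
  field_simp at this
  rw [neg_div]
  linear_combination this

lemma θ₂_eq (τ : ℂ) : θ₂ τ = cexp (Real.pi * I * τ / 4) * jacobiTheta₂ (-τ / 2) τ := by
  rw [θ₂, jacobiTheta₂, ← tsum_mul_left]
  refine tsum_congr fun n ↦ ?_
  rw [qpow, jacobiTheta₂_term, ← Complex.exp_add]
  push_cast
  ring_nf

lemma θ₃_eq (τ : ℂ) : θ₃ τ = jacobiTheta₂ 0 τ := by
  refine tsum_congr fun n ↦ ?_
  rw [qpow, jacobiTheta₂_term]
  push_cast
  ring_nf

lemma θ₄_eq (τ : ℂ) : θ₄ τ = jacobiTheta₂ (1 / 2) τ := by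
  refine tsum_congr fun n ↦ ?_
  rw [qpow, jacobiTheta₂_term, ← exp_pi_mul_I, ← Complex.exp_int_mul, ← Complex.exp_add]
  push_cast
  ring_nf

lemma η_eq_eta : η = ModularForm.eta := by
  ext τ
  rw [η, ModularForm.eta, qpow, Function.Periodic.qParam]
  simp_rw [ModularForm.eta_q_eq_pow, qexp]
  push_cast
  ring_nf

/-- The product formula `2 η³ = θ₂ θ₃ θ₄`. -/
lemma θ₂_mul_θ₃_mul_θ₄ {τ : ℂ} (hτ : 0 < τ.im) : θ₂ τ * θ₃ τ * θ₄ τ = 2 * η τ ^ 3 := by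
  have h : qpow (1 / 24) τ ^ 3 = cexp (Real.pi * I * τ / 4) := by
    rw [qpow, ← Complex.exp_nat_mul]
    push_cast
    ring_nf
  rw [θ₂_eq, θ₃_eq, θ₄_eq, η, mul_pow, h]
  linear_combination cexp (Real.pi * I * τ / 4) * jacobiTheta₂_mul_mul hτ

/-- Jacobi's derivative formula: `η'/η = (1/6)(ξ₂ + ξ₃ + ξ₄)` on `ℍ`. -/
theorem eta_log_deriv (τ : ℂ) (hτ : 0 < τ.im) :
    Dq η τ / η τ = (1/6) * (ξ₂ τ + ξ₃ τ + ξ₄ τ) := by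
  have hη : DifferentiableAt ℂ η τ :=
    η_eq_eta ▸ ModularForm.differentiableAt_eta_of_mem_upperHalfPlaneSet hτ
  have hη0 : η τ ≠ 0 := η_eq_eta ▸ ModularForm.eta_ne_zero hτ
  have h₂ : DifferentiableAt ℂ θ₂ τ := by
    rw [funext θ₂_eq]
    have h := (hasFDerivAt_jacobiTheta₂ (-τ / 2) hτ).differentiableAt.comp τ
      (f := fun t : ℂ ↦ (-t / 2, t)) (by fun_prop)
    exact DifferentiableAt.mul (by fun_prop) h
  have h₃ : DifferentiableAt ℂ θ₃ τ :=
    funext θ₃_eq ▸ differentiableAt_jacobiTheta₂_snd 0 hτ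
  have h₄ : DifferentiableAt ℂ θ₄ τ :=
    funext θ₄_eq ▸ differentiableAt_jacobiTheta₂_snd (1 / 2) hτ
  have hprod := θ₂_mul_θ₃_mul_θ₄ hτ
  have hne : θ₂ τ * θ₃ τ * θ₄ τ ≠ 0 := hprod ▸ by simpa using hη0
  obtain ⟨⟨h₂0, h₃0⟩, h₄0⟩ : (θ₂ τ ≠ 0 ∧ θ₃ τ ≠ 0) ∧ θ₄ τ ≠ 0 := by
    simpa only [mul_ne_zero_iff] using hne
  have hev : (fun t ↦ θ₂ t * θ₃ t * θ₄ t) =ᶠ[𝓝 τ] fun t ↦ 2 * η t ^ 3 := by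
    filter_upwards [(isOpen_lt continuous_const Complex.continuous_im).mem_nhds hτ] with t ht
    exact θ₂_mul_θ₃_mul_θ₄ ht
  have hd := hev.deriv_eq
  have hl := ((h₂.hasDerivAt.mul h₃.hasDerivAt).mul h₄.hasDerivAt).deriv
  have hr := ((hη.hasDerivAt.pow 3).const_mul 2).deriv
  have key : (deriv θ₂ τ * θ₃ τ + θ₂ τ * deriv θ₃ τ) * θ₄ τ + θ₂ τ * θ₃ τ * deriv θ₄ τ =
      2 * (3 * η τ ^ 2 * deriv η τ) := by
    refine hl.symm.trans (hd.trans (hr.trans ?_))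
    norm_num
  have hlog : deriv θ₂ τ / θ₂ τ + deriv θ₃ τ / θ₃ τ + deriv θ₄ τ / θ₄ τ =
      3 * (deriv η τ / η τ) := by
    have hL : deriv θ₂ τ / θ₂ τ + deriv θ₃ τ / θ₃ τ + deriv θ₄ τ / θ₄ τ =
        ((deriv θ₂ τ * θ₃ τ + θ₂ τ * deriv θ₃ τ) * θ₄ τ + θ₂ τ * θ₃ τ * deriv θ₄ τ) /
          (θ₂ τ * θ₃ τ * θ₄ τ) := by
      field_simp
    rw [hL, key, hprod]
    field_simp
  simp only [ξ₂, ξ₃, ξ₄, Dq]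
  linear_combination (-1 / (3 * (2 * Real.pi * I))) * hlog
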